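/- arXiv:2011.00889 — 2 statements merged into one kernel-verified Lean document; each statement's English description precedes it below -/
import Mathlib

section
/- Let W, W', Y, Z, S be random variables on a common probability space taking values in finite measurable types, and let ε ≥ 0. Assume: (i) I(W ; W' | S) = 0; (ii) I(W ; Z | S) ≤ ε; (iii) H(W' | (Z, S)) ≤ ε. Then I(W ; Y | (W', S)) ≤ I(W ; Y | (W', Z, S)) + 2ε. -/
open MeasureTheory

namespace Paper

variable {Ω : Type*} [MeasurableSpace Ω]

/-- Shannon entropy of a finitely-valued random variable. -/
noncomputable def entH {S : Type*} [Fintype S] [MeasurableSpace S]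
    (μ : Measure Ω) (X : Ω → S) : ℝ :=
  ∑ s : S, Real.negMulLog ((μ.map X) {s}).toReal

/-- Conditional Shannon entropy `H(X | Y)`. -/
noncomputable def condH {S T : Type*} [Fintype S] [MeasurableSpace S]
    [Fintype T] [MeasurableSpace T] (μ : Measure Ω) (X : Ω → S) (Y : Ω → T) : ℝ :=
  entH μ (fun ω => (X ω, Y ω)) - entH μ Y

/-- Mutual information `I(X ; Y)`. -/
noncomputable def mutI {S T : Type*} [Fintype S] [MeasurableSpace S]
    [Fintype T] [MeasurableSpace T] (μ : Measure Ω) (X : Ω → S) (Y : Ω → T) : ℝ :=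
  entH μ X + entH μ Y - entH μ (fun ω => (X ω, Y ω))

/-- Conditional mutual information `I(X ; Y | Z)`. -/
noncomputable def condI {S T U : Type*} [Fintype S] [MeasurableSpace S]
    [Fintype T] [MeasurableSpace T] [Fintype U] [MeasurableSpace U]
    (μ : Measure Ω) (X : Ω → S) (Y : Ω → T) (Z : Ω → U) : ℝ :=
  condH μ X Z + condH μ Y Z - condH μ (fun ω => (X ω, Y ω)) Z

/-- Finite form of strong subadditivity of Shannon entropy. -/
theorem negMulLog_sum_submodular {S T U : Type*} [Fintype S] [Fintype T] [Fintype U]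
    (p : S → T → U → ℝ) (hp : ∀ x y z, 0 ≤ p x y z) :
    ∑ x, ∑ y, ∑ z, Real.negMulLog (p x y z) + ∑ z, Real.negMulLog (∑ x, ∑ y, p x y z) ≤
      ∑ x, ∑ z, Real.negMulLog (∑ y, p x y z) + ∑ y, ∑ z, Real.negMulLog (∑ x, p x y z) := by
  set a : S → U → ℝ := fun x z => ∑ y, p x y z
  set b : T → U → ℝ := fun y z => ∑ x, p x y z
  set c : U → ℝ := fun z => ∑ x, ∑ y, p x y z
  have hca (z) : ∑ x, a x z = c z := rfl
  have hcb (z) : ∑ y, b y z = c z := Finset.sum_comm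
  have ha0 (x z) : 0 ≤ a x z := Finset.sum_nonneg fun y _ => hp x y z
  have hb0 (y z) : 0 ≤ b y z := Finset.sum_nonneg fun x _ => hp x y z
  have pointwise (x y z) :
      p x y z * (Real.log (a x z) + Real.log (b y z) - Real.log (c z) - Real.log (p x y z)) ≤
        a x z * b y z / c z - p x y z := by
    have hpa : p x y z ≤ a x z :=
      Finset.single_le_sum (f := fun y => p x y z) (fun y _ => hp x y z) (Finset.mem_univ y)
    have hpb : p x y z ≤ b y z :=
      Finset.single_le_sum (f := fun x => p x y z) (fun x _ => hp x y z) (Finset.mem_univ x)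
    have hac : a x z ≤ c z :=
      Finset.single_le_sum (f := fun x => a x z) (fun x _ => ha0 x z) (Finset.mem_univ x)
    rcases (hp x y z).eq_or_lt with h | h
    · rw [← h, zero_mul, sub_zero]
      exact div_nonneg (mul_nonneg (ha0 x z) (hb0 y z)) ((ha0 x z).trans hac)
    · have ha' := h.trans_le hpa
      have hb' := h.trans_le hpb
      have hc' := ha'.trans_le hac
      have key := Real.log_le_sub_one_of_pos
        (div_pos (div_pos (mul_pos ha' hb') hc') h)
      rw [Real.log_div (by positivity) h.ne', Real.log_div (by positivity) hc'.ne',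
        Real.log_mul ha'.ne' hb'.ne'] at key
      refine (mul_le_mul_of_nonneg_left key h.le).trans_eq ?_
      field_simp
  have total : ∑ x, ∑ y, ∑ z, (a x z * b y z / c z - p x y z) = 0 := by
    simp_rw [Finset.sum_comm (s := (Finset.univ : Finset T))]
    rw [Finset.sum_comm]
    refine Finset.sum_eq_zero fun z _ => ?_
    simp_rw [Finset.sum_sub_distrib, ← Finset.sum_div, ← Finset.mul_sum, hcb, ← Finset.sum_mul, hca]
    rw [mul_self_div_self]
    exact sub_self _
  have summed := (Finset.sum_le_sum fun x (_ : x ∈ Finset.univ) =>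
    Finset.sum_le_sum fun y (_ : y ∈ Finset.univ) =>
      Finset.sum_le_sum fun z (_ : z ∈ Finset.univ) => pointwise x y z).trans_eq total
  simp_rw [mul_sub, mul_add, Finset.sum_sub_distrib, Finset.sum_add_distrib] at summed
  have sum_a : ∑ x, ∑ y, ∑ z, p x y z * Real.log (a x z) = ∑ x, ∑ z, a x z * Real.log (a x z) := by
    refine Finset.sum_congr rfl fun x _ => ?_
    rw [Finset.sum_comm]
    simp_rw [← Finset.sum_mul]
    rfl
  have sum_b : ∑ x, ∑ y, ∑ z, p x y z * Real.log (b y z) = ∑ y, ∑ z, b y z * Real.log (b y z) := by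
    rw [Finset.sum_comm]
    refine Finset.sum_congr rfl fun y _ => ?_
    rw [Finset.sum_comm]
    simp_rw [← Finset.sum_mul]
    rfl
  have sum_c : ∑ x, ∑ y, ∑ z, p x y z * Real.log (c z) = ∑ z, c z * Real.log (c z) := by
    simp_rw [Finset.sum_comm (s := (Finset.univ : Finset T))]
    rw [Finset.sum_comm]
    simp_rw [← Finset.sum_mul]
    rfl
  rw [sum_a, sum_b, sum_c] at summed
  simp only [Real.negMulLog, neg_mul, Finset.sum_neg_distrib]
  linarith

/-- Entropy is invariant under injective relabelling. -/
theorem entH_comp_of_injective {S T : Type*}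
    [Fintype S] [MeasurableSpace S] [MeasurableSingletonClass S]
    [Fintype T] [MeasurableSpace T] [MeasurableSingletonClass T]
    (μ : Measure Ω) {X : Ω → S} (hX : Measurable X) {f : S → T} (hf : Function.Injective f) :
    entH μ (fun ω => f (X ω)) = entH μ X := by
  have hfX : Measurable fun ω => f (X ω) := (Measurable.of_discrete (f := f)).comp hX
  refine (Fintype.sum_of_injective f hf _ _ (fun t ht => ?_) fun s => ?_).symm
  · have : (fun ω => f (X ω)) ⁻¹' {t} = ∅ := by
      ext ω
      simpa using fun h => ht ⟨X ω, h⟩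
    rw [Measure.map_apply hfX (measurableSet_singleton t), this]
    simp
  · rw [Measure.map_apply hfX (measurableSet_singleton _),
      Measure.map_apply hX (measurableSet_singleton s)]
    congr 3
    ext ω
    simp [hf.eq_iff]

/-- The law of a function of a finitely-valued random variable, as a sum over the fibre. -/
theorem toReal_map_comp_singleton {S T : Type*}
    [Fintype S] [MeasurableSpace S] [MeasurableSingletonClass S]
    [MeasurableSpace T] [MeasurableSingletonClass T] [DecidableEq T]
    (μ : Measure Ω) [IsFiniteMeasure μ] {X : Ω → S} (hX : Measurable X) (f : S → T) (t : T) :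
    ((μ.map fun ω => f (X ω)) {t}).toReal =
      ∑ s, if f s = t then ((μ.map X) {s}).toReal else 0 := by
  have hf : Measurable f := Measurable.of_discrete
  have : (μ.map fun ω => f (X ω)) = (μ.map X).map f := (Measure.map_map hf hX).symm
  rw [this, Measure.map_apply hf (measurableSet_singleton t), ← Finset.sum_filter,
    ← ENNReal.toReal_sum (fun _ _ => measure_ne_top _ _), sum_measure_singleton]
  congr 2
  ext s
  simp

/-- Conditional mutual information is nonnegative. -/
theorem condI_nonneg {S T U : Type*}
    [Fintype S] [MeasurableSpace S] [MeasurableSingletonClass S]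
    [Fintype T] [MeasurableSpace T] [MeasurableSingletonClass T]
    [Fintype U] [MeasurableSpace U] [MeasurableSingletonClass U]
    (μ : Measure Ω) [IsFiniteMeasure μ] {X : Ω → S} {Y : Ω → T} {Z : Ω → U}
    (hX : Measurable X) (hY : Measurable Y) (hZ : Measurable Z) :
    0 ≤ condI μ X Y Z := by
  classical
  have hV : Measurable fun ω => ((X ω, Y ω), Z ω) := (hX.prodMk hY).prodMk hZ
  have law_Z := toReal_map_comp_singleton μ hV Prod.snd
  have law_XZ := toReal_map_comp_singleton μ hV fun v => (v.1.1, v.2)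
  have law_YZ := toReal_map_comp_singleton μ hV fun v => (v.1.2, v.2)
  have key := negMulLog_sum_submodular
    (fun x y z => ((μ.map fun ω => ((X ω, Y ω), Z ω)) {((x, y), z)}).toReal)
    fun _ _ _ => ENNReal.toReal_nonneg
  simp only [condI, condH, entH, law_Z, law_XZ, law_YZ, Fintype.sum_prod_type, Prod.mk.injEq,
    ite_and, Finset.sum_ite_eq', Finset.sum_ite_irrel, Finset.sum_const_zero, Finset.mem_univ,
    if_true]
  linarith

/-- Conditional entropy is nonnegative. -/
theorem condH_nonneg {S T : Type*}
    [Fintype S] [MeasurableSpace S] [MeasurableSingletonClass S]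
    [Fintype T] [MeasurableSpace T] [MeasurableSingletonClass T]
    (μ : Measure Ω) [IsFiniteMeasure μ] {X : Ω → S} {Y : Ω → T}
    (hX : Measurable X) (hY : Measurable Y) :
    0 ≤ condH μ X Y := by
  have h := condI_nonneg μ hX hX hY
  have e := entH_comp_of_injective μ (hX.prodMk hY)
    (f := fun v => ((v.1, v.1), v.2)) (fun _ _ h => by simp_all [Prod.ext_iff])
  simp only [condI, condH] at h e ⊢
  linarith

/-- If `W` and `W'` are conditionally independent given `S`, `I(W ; Z | S) ≤ ε`
and `H(W' | (Z, S)) ≤ ε`, then `I(W ; Y | (W', S)) ≤ I(W ; Y | (W', Z, S)) + 2ε`. -/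
theorem stmt_1 {Ω : Type*} [MeasurableSpace Ω] (μ : Measure Ω) [IsProbabilityMeasure μ]
    {𝒲 𝒲' 𝒴 𝒵 𝒮 : Type*}
    [Fintype 𝒲] [Nonempty 𝒲] [MeasurableSpace 𝒲] [MeasurableSingletonClass 𝒲]
    [Fintype 𝒲'] [Nonempty 𝒲'] [MeasurableSpace 𝒲'] [MeasurableSingletonClass 𝒲']
    [Fintype 𝒴] [Nonempty 𝒴] [MeasurableSpace 𝒴] [MeasurableSingletonClass 𝒴]
    [Fintype 𝒵] [Nonempty 𝒵] [MeasurableSpace 𝒵] [MeasurableSingletonClass 𝒵]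
    [Fintype 𝒮] [Nonempty 𝒮] [MeasurableSpace 𝒮] [MeasurableSingletonClass 𝒮]
    (W : Ω → 𝒲) (W' : Ω → 𝒲') (Y : Ω → 𝒴) (Z : Ω → 𝒵) (S : Ω → 𝒮)
    (hW : Measurable W) (hW' : Measurable W') (hY : Measurable Y)
    (hZ : Measurable Z) (hS : Measurable S)
    {ε : ℝ} (hε : 0 ≤ ε)
    (hindep : condI μ W W' S = 0)
    (hsec : condI μ W Z S ≤ ε)
    (hfano : condH μ W' (fun ω => (Z ω, S ω)) ≤ ε) :
    condI μ W Y (fun ω => (W' ω, S ω)) ≤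
      condI μ W Y (fun ω => (W' ω, Z ω, S ω)) + 2 * ε := by
  have hYZ := condI_nonneg μ hW hZ (hY.prodMk (hW'.prodMk hS))
  have hcond := condH_nonneg μ hW' (hW.prodMk (hZ.prodMk hS))
  have e_WYWS := entH_comp_of_injective μ (hW.prodMk (hY.prodMk (hW'.prodMk hS)))
    (f := fun v => ((v.1, v.2.1), v.2.2)) (fun _ _ h => by simp_all [Prod.ext_iff])
  have e_ZYWS := entH_comp_of_injective μ (hZ.prodMk (hY.prodMk (hW'.prodMk hS)))
    (f := fun v => (v.2.1, v.2.2.1, v.1, v.2.2.2)) (fun _ _ h => by simp_all [Prod.ext_iff])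
  have e_WZYWS := entH_comp_of_injective μ ((hW.prodMk hZ).prodMk (hY.prodMk (hW'.prodMk hS)))
    (f := fun v => ((v.1.1, v.2.1), v.2.2.1, v.1.2, v.2.2.2)) (fun _ _ h => by simp_all [Prod.ext_iff])
  have e_WZS := entH_comp_of_injective μ (hW.prodMk (hZ.prodMk hS))
    (f := fun v => ((v.1, v.2.1), v.2.2)) (fun _ _ h => by simp_all [Prod.ext_iff])
  have e_WWS := entH_comp_of_injective μ (hW.prodMk (hW'.prodMk hS))
    (f := fun v => ((v.1, v.2.1), v.2.2)) (fun _ _ h => by simp_all [Prod.ext_iff])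
  have e_WWZS := entH_comp_of_injective μ (hW'.prodMk (hW.prodMk (hZ.prodMk hS)))
    (f := fun v => (v.2.1, v.1, v.2.2)) (fun _ _ h => by simp_all [Prod.ext_iff])
  simp only [condI, condH] at *
  linarith

end Paper
end

section
/- Let T be a natural number and let A₁,…,A_T, Ã₁,…,Ã_T, B₁,…,B_T, C be random variables on a common probability space taking values in finite measurable types. Assume that for every t ∈ {1,…,T}: (i) H(Ã_t | (A₁,…,A_{t−1}, C)) = H(A_t | (A₁,…,A_{t−1}, C)); and (ii) B_t = g_t(A_t, Ã_t) almost surely for some measurable function g_t. Then 2·H((A₁,…,A_T) | C) ≥ H((A₁,…,A_T, B₁,…,B_T) | C). -/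
open MeasureTheory

namespace Paper

variable {Ω : Type*} [MeasurableSpace Ω]

/-- Submodularity of the entropy sums of the marginals, which amounts to
nonnegativity of conditional mutual information for a finite nonnegative array. -/
theorem sum_negMulLog_add_le {α β γ : Type*} [Fintype α] [Fintype β] [Fintype γ]
    (p : α → β → γ → ℝ) (hp : ∀ x y z, 0 ≤ p x y z) :
    ∑ x, ∑ y, ∑ z, Real.negMulLog (p x y z) + ∑ z, Real.negMulLog (∑ x, ∑ y, p x y z) ≤
      ∑ x, ∑ z, Real.negMulLog (∑ y, p x y z) + ∑ y, ∑ z, Real.negMulLog (∑ x, p x y z) := by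
  set pz : γ → ℝ := fun z => ∑ x, ∑ y, p x y z with hpz
  set px : α → γ → ℝ := fun x z => ∑ y, p x y z with hpx
  set py : β → γ → ℝ := fun y z => ∑ x, p x y z with hpy
  have px_nonneg x z : 0 ≤ px x z := Finset.sum_nonneg fun y _ => hp x y z
  have py_nonneg y z : 0 ≤ py y z := Finset.sum_nonneg fun x _ => hp x y z
  have le_px x y z : p x y z ≤ px x z :=
    Finset.single_le_sum (f := fun y => p x y z) (fun y _ => hp x y z) (Finset.mem_univ y)
  have le_py x y z : p x y z ≤ py y z :=
    Finset.single_le_sum (f := fun x => p x y z) (fun x _ => hp x y z) (Finset.mem_univ x)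
  have px_le x z : px x z ≤ pz z :=
    Finset.single_le_sum (f := fun x => px x z) (fun x _ => px_nonneg x z) (Finset.mem_univ x)
  have sum_py z : ∑ y, py y z = pz z := Finset.sum_comm
  have pointwise x y z :
      p x y z * (Real.log (px x z) + Real.log (py y z) - Real.log (p x y z) - Real.log (pz z)) ≤
        px x z * py y z / pz z - p x y z := by
    rcases (hp x y z).eq_or_lt with h | h
    · rw [← h, zero_mul, sub_zero]
      exact div_nonneg (mul_nonneg (px_nonneg x z) (py_nonneg y z))
        ((px_nonneg x z).trans (px_le x z))
    · have h1 : 0 < px x z := h.trans_le (le_px x y z)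
      have h2 : 0 < py y z := h.trans_le (le_py x y z)
      have h3 : 0 < pz z := h1.trans_le (px_le x z)
      have key := Real.log_le_sub_one_of_pos (x := px x z * py y z / (p x y z * pz z))
        (by positivity)
      rw [Real.log_div (by positivity) (by positivity), Real.log_mul h1.ne' h2.ne',
        Real.log_mul h.ne' h3.ne'] at key
      calc _ = p x y z * (Real.log (px x z) + Real.log (py y z) -
              (Real.log (p x y z) + Real.log (pz z))) := by ring
        _ ≤ p x y z * (px x z * py y z / (p x y z * pz z) - 1) :=
            mul_le_mul_of_nonneg_left key h.le
        _ = _ := by field_simp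
  have total : ∑ x, ∑ y, ∑ z, p x y z *
      (Real.log (px x z) + Real.log (py y z) - Real.log (p x y z) - Real.log (pz z)) ≤ 0 := by
    calc _ ≤ ∑ x, ∑ y, ∑ z, (px x z * py y z / pz z - p x y z) :=
          Finset.sum_le_sum fun x _ => Finset.sum_le_sum fun y _ =>
            Finset.sum_le_sum fun z _ => pointwise x y z
      _ = ∑ z, ∑ x, ∑ y, (px x z * py y z / pz z - p x y z) := by
          rw [Finset.sum_comm]
          simp_rw [Finset.sum_comm (s := (Finset.univ : Finset α)) (t := (Finset.univ : Finset γ))]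
          rw [Finset.sum_comm]
          exact Finset.sum_congr rfl fun z _ => Finset.sum_comm
      _ = 0 := by
          refine Finset.sum_eq_zero fun z _ => ?_
          simp_rw [Finset.sum_sub_distrib, ← Finset.sum_div, ← Finset.mul_sum, sum_py,
            ← Finset.sum_mul]
          exact sub_eq_zero.2 (mul_self_div_self (pz z))
  have hxz : ∑ x, ∑ z, Real.negMulLog (px x z) =
      -∑ x, ∑ y, ∑ z, p x y z * Real.log (px x z) := by
    simp_rw [Finset.sum_comm (s := (Finset.univ : Finset β)), ← Finset.sum_mul, Real.negMulLog,
      neg_mul, Finset.sum_neg_distrib]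
    rfl
  have hyz : ∑ y, ∑ z, Real.negMulLog (py y z) =
      -∑ x, ∑ y, ∑ z, p x y z * Real.log (py y z) := by
    rw [Finset.sum_comm (s := (Finset.univ : Finset α))]
    simp_rw [Finset.sum_comm (s := (Finset.univ : Finset α)), ← Finset.sum_mul, Real.negMulLog,
      neg_mul, Finset.sum_neg_distrib]
    rfl
  have hz : ∑ z, Real.negMulLog (pz z) = -∑ x, ∑ y, ∑ z, p x y z * Real.log (pz z) := by
    simp_rw [Finset.sum_comm (s := (Finset.univ : Finset β))]
    rw [Finset.sum_comm]
    simp_rw [← Finset.sum_mul, Real.negMulLog, neg_mul, Finset.sum_neg_distrib]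
    rfl
  have hxyz : ∑ x, ∑ y, ∑ z, Real.negMulLog (p x y z) =
      -∑ x, ∑ y, ∑ z, p x y z * Real.log (p x y z) := by
    simp_rw [Real.negMulLog, neg_mul, Finset.sum_neg_distrib]
  simp_rw [mul_sub, mul_add, Finset.sum_sub_distrib, Finset.sum_add_distrib] at total
  linarith

/-- `-x log x` is subadditive over finite sums of nonnegative reals. -/
theorem negMulLog_sum_le {ι : Type*} (s : Finset ι) (p : ι → ℝ) (hp : ∀ i ∈ s, 0 ≤ p i) :
    Real.negMulLog (∑ i ∈ s, p i) ≤ ∑ i ∈ s, Real.negMulLog (p i) := by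
  rw [Real.negMulLog, ← Finset.sum_neg_distrib, Finset.sum_mul]
  refine Finset.sum_le_sum fun i hi => ?_
  rcases (hp i hi).eq_or_lt with h | h
  · simp [← h]
  · rw [Real.negMulLog]
    have := Real.log_le_log h (Finset.single_le_sum hp hi)
    nlinarith

/-- The point masses of a function of `X` are sums of point masses of `X` over the fibres. -/
theorem map_comp_singleton_toReal {S T : Type*} [Fintype S] [MeasurableSpace S]
    [MeasurableSingletonClass S] [MeasurableSpace T] [MeasurableSingletonClass T] [DecidableEq T]
    (μ : Measure Ω) [IsFiniteMeasure μ] {X : Ω → S} (hX : Measurable X) (f : S → T) (t : T) :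
    ((μ.map fun ω => f (X ω)) {t}).toReal = ∑ s with f s = t, ((μ.map X) {s}).toReal := by
  have hf : Measurable f := measurable_of_finite f
  change (μ.map (f ∘ X)).real {t} = ∑ s with f s = t, (μ.map X).real {s}
  rw [← Measure.map_map hf hX, sum_measureReal_singleton,
    map_measureReal_apply hf (measurableSet_singleton t)]
  congr 1
  ext s
  simp

/-- Entropy depends only on the almost-everywhere class of a random variable. -/
theorem entH_congr_ae {S : Type*} [Fintype S] [MeasurableSpace S] {μ : Measure Ω} {X Y : Ω → S}
    (h : X =ᵐ[μ] Y) : entH μ X = entH μ Y := by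
  simp only [entH, Measure.map_congr h]

/-- Entropy does not increase under functions. -/
theorem entH_comp_le {S T : Type*} [Fintype S] [MeasurableSpace S] [MeasurableSingletonClass S]
    [Fintype T] [MeasurableSpace T] [MeasurableSingletonClass T]
    (μ : Measure Ω) [IsFiniteMeasure μ] {X : Ω → S} (hX : Measurable X) (f : S → T) :
    entH μ (fun ω => f (X ω)) ≤ entH μ X := by
  classical
  simp only [entH, map_comp_singleton_toReal μ hX]
  calc _ ≤ ∑ t, ∑ s with f s = t, Real.negMulLog ((μ.map X) {s}).toReal :=
        Finset.sum_le_sum fun t _ => negMulLog_sum_le _ _ fun _ _ => ENNReal.toReal_nonneg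
    _ = _ := Finset.sum_fiberwise _ _ _

/-- A random variable determined by `X` has at most the entropy of `X`. -/
theorem entH_le_of_factorsThrough {S T : Type*} [Fintype S] [MeasurableSpace S]
    [MeasurableSingletonClass S] [Fintype T] [MeasurableSpace T] [MeasurableSingletonClass T]
    (μ : Measure Ω) [IsProbabilityMeasure μ] {X : Ω → S} {Y : Ω → T} (hX : Measurable X)
    (h : Function.FactorsThrough Y X) : entH μ Y ≤ entH μ X := by
  obtain ⟨ω₀⟩ := nonempty_of_isProbabilityMeasure μ
  have hY : Y = fun ω => Function.extend X Y (fun _ => Y ω₀) (X ω) :=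
    funext fun ω => (h.extend_apply _ ω).symm
  rw [hY]
  exact entH_comp_le μ hX _

/-- Submodularity of entropy: `H(X, Y, Z) + H(Z) ≤ H(X, Z) + H(Y, Z)`. -/
theorem entH_submodular {S T U : Type*} [Fintype S] [MeasurableSpace S]
    [MeasurableSingletonClass S] [Fintype T] [MeasurableSpace T] [MeasurableSingletonClass T]
    [Fintype U] [MeasurableSpace U] [MeasurableSingletonClass U]
    (μ : Measure Ω) [IsFiniteMeasure μ] {X : Ω → S} {Y : Ω → T} {Z : Ω → U}
    (hX : Measurable X) (hY : Measurable Y) (hZ : Measurable Z) :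
    entH μ (fun ω => (X ω, Y ω, Z ω)) + entH μ Z ≤
      entH μ (fun ω => (X ω, Z ω)) + entH μ (fun ω => (Y ω, Z ω)) := by
  classical
  have hW : Measurable fun ω => (X ω, Y ω, Z ω) := hX.prodMk (hY.prodMk hZ)
  set p : S → T → U → ℝ := fun x y z => ((μ.map fun ω => (X ω, Y ω, Z ω)) {(x, y, z)}).toReal
  have hz z : ((μ.map Z) {z}).toReal = ∑ x, ∑ y, p x y z := by
    rw [map_comp_singleton_toReal μ hW (fun w => w.2.2) z]
    simp [Finset.sum_filter, Fintype.sum_prod_type, p]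
  have hxz x z : ((μ.map fun ω => (X ω, Z ω)) {(x, z)}).toReal = ∑ y, p x y z := by
    rw [map_comp_singleton_toReal μ hW (fun w => (w.1, w.2.2)) (x, z)]
    simp [Finset.sum_filter, Fintype.sum_prod_type, p, ite_and]
  have hyz y z : ((μ.map fun ω => (Y ω, Z ω)) {(y, z)}).toReal = ∑ x, p x y z := by
    rw [map_comp_singleton_toReal μ hW (fun w => (w.2.1, w.2.2)) (y, z)]
    simp [Finset.sum_filter, Fintype.sum_prod_type, p]
  simp only [entH, Fintype.sum_prod_type, hz, hxz, hyz]
  exact sum_negMulLog_add_le p fun _ _ _ => ENNReal.toReal_nonneg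

/-- Single-letter entropy doubling: if `A'` is as uncertain as `A` given `Z`, and `B` is almost
surely a function of `(A, A')`, then `H(A, B, Z) + H(Z) ≤ 2 H(A, Z)`. -/
theorem entH_add_le_two_mul {S S' T U : Type*} [Fintype S] [MeasurableSpace S]
    [MeasurableSingletonClass S] [Fintype S'] [MeasurableSpace S'] [MeasurableSingletonClass S']
    [Fintype T] [MeasurableSpace T] [MeasurableSingletonClass T]
    [Fintype U] [MeasurableSpace U] [MeasurableSingletonClass U]
    (μ : Measure Ω) [IsProbabilityMeasure μ] {A : Ω → S} {A' : Ω → S'} {B : Ω → T} {Z : Ω → U}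
    (hA : Measurable A) (hA' : Measurable A') (hZ : Measurable Z)
    (hsep : condH μ A' Z = condH μ A Z) (g : S × S' → T)
    (hrec : ∀ᵐ ω ∂μ, B ω = g (A ω, A' ω)) :
    entH μ (fun ω => ((A ω, B ω), Z ω)) + entH μ Z ≤ 2 * entH μ (fun ω => (A ω, Z ω)) := by
  have hae : entH μ (fun ω => ((A ω, B ω), Z ω)) =
      entH μ (fun ω => ((A ω, g (A ω, A' ω)), Z ω)) :=
    entH_congr_ae (hrec.mono fun ω h => by simp only [h])
  have hle := entH_comp_le μ (hA.prodMk (hA'.prodMk hZ))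
    (fun w => ((w.1, g (w.1, w.2.1)), w.2.2))
  have hsub := entH_submodular μ hA hA' hZ
  simp only [condH] at hsep
  linarith

/-- Multi-letter entropy doubling (K-user SEP, Lemma 2): if at every time `t` the virtual
output `A' t` has the same conditional entropy given the past `(A 0, …, A (t-1), C)` as the
true output `A t`, and `B t` is a.s. a measurable function of `(A t, A' t)`, then
`2 H(A₁,…,A_T | C) ≥ H((A₁,…,A_T, B₁,…,B_T) | C)`. -/
theorem stmt_4 {Ω : Type*} [MeasurableSpace Ω] (μ : Measure Ω) [IsProbabilityMeasure μ]
    {T : ℕ} {α α' β : Fin T → Type*} {γ : Type*}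
    [∀ t, Fintype (α t)] [∀ t, Nonempty (α t)]
    [∀ t, MeasurableSpace (α t)] [∀ t, MeasurableSingletonClass (α t)]
    [∀ t, Fintype (α' t)] [∀ t, Nonempty (α' t)]
    [∀ t, MeasurableSpace (α' t)] [∀ t, MeasurableSingletonClass (α' t)]
    [∀ t, Fintype (β t)] [∀ t, Nonempty (β t)]
    [∀ t, MeasurableSpace (β t)] [∀ t, MeasurableSingletonClass (β t)]
    [Fintype γ] [Nonempty γ] [MeasurableSpace γ] [MeasurableSingletonClass γ]
    (A : ∀ t, Ω → α t) (A' : ∀ t, Ω → α' t) (B : ∀ t, Ω → β t) (C : Ω → γ)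
    (hA : ∀ t, Measurable (A t)) (hA' : ∀ t, Measurable (A' t))
    (hB : ∀ t, Measurable (B t)) (hC : Measurable C)
    (hsep : ∀ t : Fin T,
      condH μ (A' t)
        (fun ω => ((fun s : Fin t.val => A (Fin.castLE t.isLt.le s) ω), C ω)) =
      condH μ (A t)
        (fun ω => ((fun s : Fin t.val => A (Fin.castLE t.isLt.le s) ω), C ω)))
    (g : ∀ t, α t × α' t → β t) (hg : ∀ t, Measurable (g t))
    (hrec : ∀ t, ∀ᵐ ω ∂μ, B t ω = g t (A t ω, A' t ω)) :
    2 * condH μ (fun ω => fun t => A t ω) C ≥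
      condH μ (fun ω => ((fun t => A t ω), (fun t => B t ω))) C := by
  let pastA (n : ℕ) (hn : n ≤ T) (ω : Ω) := fun s : Fin n => A (Fin.castLE hn s) ω
  let pastB (n : ℕ) (hn : n ≤ T) (ω : Ω) := fun s : Fin n => B (Fin.castLE hn s) ω
  have measurable_pastA n hn : Measurable (pastA n hn) := measurable_pi_lambda _ fun _ => hA _
  have measurable_pastB n hn : Measurable (pastB n hn) := measurable_pi_lambda _ fun _ => hB _
  have doubling (n : ℕ) (hn : n ≤ T) :
      entH μ (fun ω => ((pastA n hn ω, pastB n hn ω), C ω)) + entH μ C ≤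
        2 * entH μ (fun ω => (pastA n hn ω, C ω)) := by
    induction n with
    | zero =>
      have h₁ : entH μ (fun ω => ((pastA 0 hn ω, pastB 0 hn ω), C ω)) ≤ entH μ C :=
        entH_le_of_factorsThrough μ hC fun ω ω' h =>
          Prod.ext (Subsingleton.elim _ _) h
      have h₂ : entH μ C ≤ entH μ (fun ω => (pastA 0 hn ω, C ω)) :=
        entH_le_of_factorsThrough μ ((measurable_pastA 0 hn).prodMk hC) fun ω ω' h =>
          congrArg Prod.snd h
      linarith
    | succ n ih =>
      have hn' : n ≤ T := (Nat.le_succ n).trans hn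
      specialize ih hn'
      let t : Fin T := ⟨n, hn⟩
      have hZ : Measurable fun ω => (pastA n hn' ω, C ω) := (measurable_pastA n hn').prodMk hC
      have letter := entH_add_le_two_mul μ (hA t) (hA' t) hZ (hsep t) (g t) (hrec t)
      have hsub := entH_submodular μ ((hA t).prodMk (hB t)) (measurable_pastB n hn') hZ
      have h₁ : entH μ (fun ω => ((pastA (n + 1) hn ω, pastB (n + 1) hn ω), C ω)) ≤
          entH μ (fun ω => ((A t ω, B t ω), pastB n hn' ω, pastA n hn' ω, C ω)) := by
        refine entH_le_of_factorsThrough μ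
          (((hA t).prodMk (hB t)).prodMk ((measurable_pastB n hn').prodMk hZ)) fun ω ω' h => ?_
        simp only [Prod.mk.injEq] at h ⊢
        obtain ⟨⟨hAt, hBt⟩, hBn, hAn, hCω⟩ := h
        exact ⟨⟨funext (Fin.lastCases hAt (congrFun hAn)),
          funext (Fin.lastCases hBt (congrFun hBn))⟩, hCω⟩
      have h₂ : entH μ (fun ω => (pastB n hn' ω, pastA n hn' ω, C ω)) ≤
          entH μ (fun ω => ((pastA n hn' ω, pastB n hn' ω), C ω)) :=
        entH_comp_le μ (((measurable_pastA n hn').prodMk (measurable_pastB n hn')).prodMk hC)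
          fun w => (w.1.2, w.1.1, w.2)
      have h₃ : entH μ (fun ω => (A t ω, pastA n hn' ω, C ω)) ≤
          entH μ (fun ω => (pastA (n + 1) hn ω, C ω)) := by
        refine entH_le_of_factorsThrough μ ((measurable_pastA (n + 1) hn).prodMk hC)
          fun ω ω' h => ?_
        simp only [Prod.mk.injEq] at h ⊢
        exact ⟨congrFun h.1 (Fin.last n), funext fun s => congrFun h.1 s.castSucc, h.2⟩
      linarith
  have hT := doubling T le_rfl
  change entH μ (fun ω => (((fun t => A t ω), (fun t => B t ω)), C ω)) + entH μ C ≤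
    2 * entH μ (fun ω => ((fun t => A t ω), C ω)) at hT
  simp only [condH]
  linarith

end Paper
end
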